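/- Let X : Ω → ℝ^ℓ and Y : Ω → ℝ^m be measurable random variables on a probability space (Ω, μ), and let 1 ≤ p < ∞. Suppose the kernel regression loss vanishes: for every ε > 0 there exists a continuous function f : ℝ^ℓ → ℝ^m with ∫ ‖Y ω − f (X ω)‖^p dμ(ω) < ε. Then there exists a Borel measurable function g : ℝ^ℓ → ℝ^m such that Y = g ∘ X holds μ-almost everywhere. -/

import Mathlib

open MeasureTheory
open Filter Topology

/-- A sequence whose `Lᵖ` errors are summable converges almost everywhere. -/
lemma ae_tendsto_of_tsum_lintegral_ne_top {Ω E : Type*} [MeasurableSpace Ω] {μ : Measure Ω}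
    [NormedAddCommGroup E] [SecondCountableTopology E] [MeasurableSpace E] [BorelSpace E]
    {Y : Ω → E} {F : ℕ → Ω → E} {p : ℝ} (hp : 0 < p)
    (hF : ∀ n, Measurable (F n)) (hY : Measurable Y)
    (h : ∑' n, ∫⁻ ω, ENNReal.ofReal (‖Y ω - F n ω‖ ^ p) ∂μ ≠ ⊤) :
    ∀ᵐ ω ∂μ, Tendsto (fun n => F n ω) atTop (𝓝 (Y ω)) := by
  have hmeas : ∀ n, Measurable fun ω => ENNReal.ofReal (‖Y ω - F n ω‖ ^ p) := fun n =>
    ((hY.sub (hF n)).norm.pow_const p).ennreal_ofReal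
  rw [← lintegral_tsum fun n => (hmeas n).aemeasurable] at h
  filter_upwards [ae_lt_top (Measurable.tsum hmeas) h] with ω hω
  have hpow : Tendsto (fun n => ‖Y ω - F n ω‖ ^ p) atTop (𝓝 0) := by
    have := (ENNReal.tendsto_toReal ENNReal.zero_ne_top).comp
      (ENNReal.tendsto_atTop_zero_of_tsum_ne_top hω.ne)
    refine this.congr fun n => ENNReal.toReal_ofReal (by positivity)
  have hnorm := hpow.rpow_const (p := p⁻¹) (Or.inr (by positivity))
  rw [Real.zero_rpow (by positivity)] at hnorm
  rw [tendsto_iff_norm_sub_tendsto_zero]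
  refine hnorm.congr fun n => ?_
  rw [Real.rpow_rpow_inv (norm_nonneg _) hp.ne', norm_sub_rev]

/-- If the kernel regression loss of `Y` given `X` vanishes (the `Lᵖ` distance between `Y` and
`f (X ·)` can be made arbitrarily small over continuous `f`), then `Y` is `μ`-almost everywhere
a Borel measurable function of `X`. -/
theorem exists_measurable_factor_of_kr_loss_eq_zero
    {Ω : Type*} [MeasurableSpace Ω] (μ : Measure Ω) [IsProbabilityMeasure μ]
    {l m : ℕ}
    (X : Ω → EuclideanSpace ℝ (Fin l)) (Y : Ω → EuclideanSpace ℝ (Fin m))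
    (hX : Measurable X) (hY : Measurable Y)
    (p : ℝ) (hp : 1 ≤ p)
    (h : ∀ ε : ℝ, 0 < ε → ∃ f : EuclideanSpace ℝ (Fin l) → EuclideanSpace ℝ (Fin m),
      Continuous f ∧
        ∫⁻ ω, ENNReal.ofReal (‖Y ω - f (X ω)‖ ^ p) ∂μ < ENNReal.ofReal ε) :
    ∃ g : EuclideanSpace ℝ (Fin l) → EuclideanSpace ℝ (Fin m),
      Measurable g ∧ ∀ᵐ ω ∂μ, Y ω = g (X ω) := by
  have hε : ∀ n : ℕ, (0 : ℝ) < (1 / 2) ^ n := fun n => by positivity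
  choose f hf hfε using fun n => h _ (hε n)
  have hp0 : 0 < p := by linarith
  have hlim := ae_tendsto_of_tsum_lintegral_ne_top hp0
    (fun n => (hf n).measurable.comp hX) hY <| by
      refine ne_top_of_le_ne_top ?_ (ENNReal.tsum_le_tsum fun n => (hfε n).le)
      exact summable_geometric_two.tsum_ofReal_ne_top
  have hexists : ∀ᵐ x ∂(μ.map X), ∃ y, Tendsto (fun n => f n x) atTop (𝓝 y) := by
    rw [ae_map_iff hX.aemeasurable (measurableSet_exists_tendsto fun n => (hf n).measurable)]
    filter_upwards [hlim] with ω hω using ⟨Y ω, hω⟩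
  obtain ⟨g, hg, hgX⟩ := measurable_limit_of_tendsto_metrizable_ae
    (fun n => (hf n).measurable.aemeasurable) hexists
  refine ⟨g, hg, ?_⟩
  filter_upwards [hlim, ae_of_ae_map hX.aemeasurable hgX] with ω hω hgω
  exact tendsto_nhds_unique hω hgω
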